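/- arXiv:2008.09065 — 6 statements merged into one kernel-verified Lean document; each statement's English description precedes it below -/
import Mathlib

section
/- Let C be a completely positive trace-preserving linear map on the space of d×d complex matrices. Then C is unital (i.e. C(I/d) = I/d) if and only if S(C(ρ)) ≥ S(ρ) for every density matrix ρ on ℂ^d. (Thermodynamically: a quantum channel provides no work benefit if and only if it is unital.) -/
open scoped ComplexOrder

/-- A density matrix: positive semidefinite with trace one. -/
def IsDensityMatrix {d : ℕ} (ρ : Matrix (Fin d) (Fin d) ℂ) : Prop :=
  ρ.PosSemidef ∧ ρ.trace = 1

/-- The von Neumann entropy `S(ρ) = -∑ₖ λₖ log λₖ` of a (Hermitian) matrix,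
with the convention `0 log 0 = 0`. -/
noncomputable def vN {d : ℕ} (ρ : Matrix (Fin d) (Fin d) ℂ) : ℝ :=
  if h : ρ.IsHermitian then ∑ k, Real.negMulLog (h.eigenvalues k) else 0

/-- Complete positivity: every amplification `id_n ⊗ Φ` (acting blockwise on
block matrices) maps positive semidefinite matrices to positive semidefinite
matrices. -/
def IsCompletelyPositive {d d' : ℕ}
    (Φ : Matrix (Fin d) (Fin d) ℂ → Matrix (Fin d') (Fin d') ℂ) : Prop :=
  ∀ (n : ℕ) (M : Matrix (Fin n × Fin d) (Fin n × Fin d) ℂ), M.PosSemidef →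
    (Matrix.of fun (p q : Fin n × Fin d') =>
      Φ (Matrix.of fun i j => M (p.1, i) (q.1, j)) p.2 q.2).PosSemidef

/-- A completely positive map is positive. -/
theorem IsCompletelyPositive.posSemidef {d d' : ℕ}
    {Φ : Matrix (Fin d) (Fin d) ℂ → Matrix (Fin d') (Fin d') ℂ} (hΦ : IsCompletelyPositive Φ)
    {A : Matrix (Fin d) (Fin d) ℂ} (hA : A.PosSemidef) : (Φ A).PosSemidef :=
  (hΦ 1 (A.submatrix Prod.snd Prod.snd) (hA.submatrix _)).submatrix fun i => (0, i)

theorem Matrix.IsHermitian.coe_eigenvalues_eq_diag {n : Type*} [Fintype n] [DecidableEq n]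
    {A : Matrix n n ℂ} (hA : A.IsHermitian) (i : n) :
    (hA.eigenvalues i : ℂ) =
      ((hA.eigenvectorUnitary : Matrix n n ℂ).conjTranspose * A * hA.eigenvectorUnitary) i i := by
  have h := congrFun (congrFun hA.conjStarAlgAut_star_eigenvectorUnitary i) i
  rw [Unitary.conjStarAlgAut_star_apply] at h
  simpa [Matrix.star_eq_conjTranspose] using h.symm

theorem Matrix.IsHermitian.eq_sum_eigenvalues_smul {n : Type*} [Fintype n] [DecidableEq n]
    {A : Matrix n n ℂ} (hA : A.IsHermitian) :
    A = ∑ j, (hA.eigenvalues j : ℂ) • ((hA.eigenvectorUnitary : Matrix n n ℂ) *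
      Matrix.single j j 1 * (hA.eigenvectorUnitary : Matrix n n ℂ).conjTranspose) := by
  conv_lhs => rw [hA.spectral_theorem, Unitary.conjStarAlgAut_apply,
    ← Matrix.sum_single_eq_diagonal]
  simp only [Matrix.mul_sum, Matrix.sum_mul, Matrix.star_eq_conjTranspose]
  refine Finset.sum_congr rfl fun j _ => ?_
  rw [← Matrix.smul_mul, ← Matrix.mul_smul, Matrix.smul_single]
  simp

theorem vN_eq_sum {d : ℕ} {ρ : Matrix (Fin d) (Fin d) ℂ} (h : ρ.IsHermitian) :
    vN ρ = ∑ k, Real.negMulLog (h.eigenvalues k) :=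
  dif_pos h

/-- Mixing a nonnegative vector by a doubly stochastic matrix does not decrease its entropy. -/
theorem sum_negMulLog_le_of_mem_doublyStochastic {n : Type*} [Fintype n] [DecidableEq n]
    {D : Matrix n n ℝ} (hD : D ∈ doublyStochastic ℝ n) {x : n → ℝ} (hx : ∀ j, 0 ≤ x j) :
    ∑ j, Real.negMulLog (x j) ≤ ∑ i, Real.negMulLog (∑ j, D i j * x j) := by
  obtain ⟨h0, hrow, hcol⟩ := mem_doublyStochastic_iff_sum.1 hD
  calc ∑ j, Real.negMulLog (x j) = ∑ i, ∑ j, D i j * Real.negMulLog (x j) := by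
        rw [Finset.sum_comm]
        simp [← Finset.sum_mul, hcol]
    _ ≤ _ := Finset.sum_le_sum fun i _ => by
        simpa using Real.concaveOn_negMulLog.le_map_sum (t := Finset.univ) (w := D i) (p := x)
          (fun j _ => h0 i j) (hrow i) (fun j _ => hx j)

theorem vN_le_of_unital {d : ℕ} {Φ : Matrix (Fin d) (Fin d) ℂ → Matrix (Fin d) (Fin d) ℂ}
    (hlin : IsLinearMap ℂ Φ) (hpos : ∀ A, A.PosSemidef → (Φ A).PosSemidef)
    (hTP : ∀ M, (Φ M).trace = M.trace) (hone : Φ 1 = 1)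
    {ρ : Matrix (Fin d) (Fin d) ℂ} (hρ : ρ.PosSemidef) : vN ρ ≤ vN (Φ ρ) := by
  have hσ := (hpos ρ hρ).isHermitian
  rw [vN_eq_sum hρ.isHermitian, vN_eq_sum hσ]
  set V : Matrix (Fin d) (Fin d) ℂ := (hσ.eigenvectorUnitary : Matrix (Fin d) (Fin d) ℂ) with hV
  let U : Matrix (Fin d) (Fin d) ℂ := hρ.isHermitian.eigenvectorUnitary
  have hVl : V.conjTranspose * V = 1 := Unitary.coe_star_mul_self hσ.eigenvectorUnitary
  have hVr : V * V.conjTranspose = 1 := Unitary.coe_mul_star_self hσ.eigenvectorUnitary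
  have hUl : U.conjTranspose * U = 1 := Unitary.coe_star_mul_self hρ.isHermitian.eigenvectorUnitary
  have hUr : U * U.conjTranspose = 1 := Unitary.coe_mul_star_self hρ.isHermitian.eigenvectorUnitary
  let P : Fin d → Matrix (Fin d) (Fin d) ℂ := fun j => U * Matrix.single j j 1 * U.conjTranspose
  have hP : ∀ j, (P j).PosSemidef := fun j => by
    refine Matrix.PosSemidef.mul_mul_conjTranspose_same ?_ U
    rw [← Matrix.diagonal_single]
    exact Matrix.PosSemidef.diagonal (Pi.single_nonneg.2 zero_le_one)
  have hPsum : ∑ j, P j = 1 := by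
    simp only [P, ← Matrix.sum_mul, ← Matrix.mul_sum, Matrix.sum_single_one, mul_one, hUr]
  have hPtr : ∀ j, (P j).trace = 1 := fun j => by
    simp only [P]
    rw [Matrix.trace_mul_comm, ← mul_assoc, hUl, one_mul, Matrix.trace_single_eq_same]
  let E : Fin d → Matrix (Fin d) (Fin d) ℂ := fun j => V.conjTranspose * Φ (P j) * V
  have hE : ∀ j, (E j).PosSemidef := fun j => (hpos _ (hP j)).conjTranspose_mul_mul_same V
  have hΦsum : ∀ f : Fin d → Matrix (Fin d) (Fin d) ℂ, Φ (∑ j, f j) = ∑ j, Φ (f j) :=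
    fun f => map_sum (hlin.mk' Φ) f Finset.univ
  have hEre : ∀ i j, ((E j i i).re : ℂ) = E j i i := fun i j =>
    (Complex.eq_re_of_ofReal_le (r := 0) (by simpa using (hE j).diag_nonneg)).symm
  have hD : Matrix.of (fun i j => (E j i i).re) ∈ doublyStochastic ℝ (Fin d) := by
    refine mem_doublyStochastic_iff_sum.2 ⟨fun i j => ?_, fun i => ?_, fun j => ?_⟩
    · exact (Complex.nonneg_iff.1 (hE j).diag_nonneg).1
    · have h : ∑ j, E j = 1 := by
        simp only [E, ← Matrix.sum_mul, ← Matrix.mul_sum, ← hΦsum, hPsum, hone, mul_one, hVl]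
      simpa [Matrix.sum_apply] using congrArg Complex.re (congrFun (congrFun h i) i)
    · have h : (E j).trace = 1 := by
        simp only [E]
        rw [Matrix.trace_mul_comm, ← mul_assoc, hVr, one_mul, hTP, hPtr]
      simpa [Matrix.trace] using congrArg Complex.re h
  have hμ : ∀ i, hσ.eigenvalues i =
      ∑ j, Matrix.of (fun i j => (E j i i).re) i j * hρ.isHermitian.eigenvalues j := fun i => by
    have h : V.conjTranspose * Φ ρ * V = ∑ j, (hρ.isHermitian.eigenvalues j : ℂ) • E j := by
      conv_lhs => rw [hρ.isHermitian.eq_sum_eigenvalues_smul, hΦsum]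
      simp only [hlin.map_smul, Matrix.mul_sum, Matrix.sum_mul, Matrix.mul_smul, Matrix.smul_mul]
      rfl
    apply Complex.ofReal_injective
    rw [hσ.coe_eigenvalues_eq_diag, ← hV, h, Matrix.sum_apply]
    simp [hEre, mul_comm]
  simp only [hμ]
  exact sum_negMulLog_le_of_mem_doublyStochastic hD hρ.eigenvalues_nonneg

theorem Matrix.IsHermitian.eigenvalues_smul_one {n : Type*} [Fintype n] [DecidableEq n]
    {c : ℝ} (h : ((c : ℂ) • (1 : Matrix n n ℂ)).IsHermitian) (i : n) : h.eigenvalues i = c := by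
  apply Complex.ofReal_injective
  have hV : (h.eigenvectorUnitary : Matrix n n ℂ).conjTranspose *
      (h.eigenvectorUnitary : Matrix n n ℂ) = 1 :=
    Unitary.coe_star_mul_self h.eigenvectorUnitary
  rw [h.coe_eigenvalues_eq_diag, Matrix.mul_smul, Matrix.smul_mul, mul_one, hV]
  simp

/-- The maximally mixed state is the only density matrix of entropy at least its own. -/
theorem eq_inv_smul_one_of_vN_le {d : ℕ} {σ : Matrix (Fin d) (Fin d) ℂ} (hσ : IsDensityMatrix σ)
    (h : vN ((d : ℂ)⁻¹ • (1 : Matrix (Fin d) (Fin d) ℂ)) ≤ vN σ) :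
    σ = (d : ℂ)⁻¹ • (1 : Matrix (Fin d) (Fin d) ℂ) := by
  rcases Nat.eq_zero_or_pos d with rfl | hd
  · exact Subsingleton.elim _ _
  have hd' : (0 : ℝ) < d := by exact_mod_cast hd
  have hH := hσ.1.isHermitian
  have hc : (d : ℂ)⁻¹ = (((d : ℝ)⁻¹ : ℝ) : ℂ) := by simp
  have hI : ((((d : ℝ)⁻¹ : ℝ) : ℂ) • (1 : Matrix (Fin d) (Fin d) ℂ)).IsHermitian := by
    simp [Matrix.IsHermitian, Matrix.conjTranspose_smul]
  have hsum : ∑ i, hH.eigenvalues i = 1 := by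
    have := hH.trace_eq_sum_eigenvalues
    rw [hσ.2] at this
    apply Complex.ofReal_injective
    simpa using this.symm
  rw [hc, vN_eq_sum hI, vN_eq_sum hH] at h
  simp only [hI.eigenvalues_smul_one, Finset.sum_const, Finset.card_univ, Fintype.card_fin,
    nsmul_eq_mul] at h
  have heq := Real.strictConcaveOn_negMulLog.eq_of_map_sum_eq (t := Finset.univ)
    (w := fun _ : Fin d => (d : ℝ)⁻¹) (p := hH.eigenvalues) (fun _ _ => inv_pos.2 hd')
    (by simp [hd'.ne']) (fun i _ => hσ.1.eigenvalues_nonneg i) (by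
      simp only [smul_eq_mul, ← Finset.mul_sum, hsum, mul_one]
      rwa [le_inv_mul_iff₀ hd'])
  have hval : ∀ i, hH.eigenvalues i = (d : ℝ)⁻¹ := fun i => by
    have h1 : ∑ j, hH.eigenvalues j = d * hH.eigenvalues i := by
      rw [Finset.sum_congr rfl fun j _ => heq (Finset.mem_univ j) (Finset.mem_univ i)]
      simp
    exact eq_inv_of_mul_eq_one_right (h1.symm.trans hsum)
  have hU : (hH.eigenvectorUnitary : Matrix (Fin d) (Fin d) ℂ) *
      (hH.eigenvectorUnitary : Matrix (Fin d) (Fin d) ℂ).conjTranspose = 1 :=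
    Unitary.coe_mul_star_self hH.eigenvectorUnitary
  conv_lhs => rw [hH.eq_sum_eigenvalues_smul]
  simp only [hval, ← Finset.smul_sum, ← Matrix.sum_mul, ← Matrix.mul_sum, Matrix.sum_single_one,
    mul_one, hU, hc]

/-- A quantum channel (CPTP map) provides no work benefit, i.e. never decreases
the von Neumann entropy of any state, if and only if it is unital. -/
theorem channel_unital_iff_entropy_nondecreasing {d : ℕ}
    (Φ : Matrix (Fin d) (Fin d) ℂ → Matrix (Fin d) (Fin d) ℂ)
    (hlin : IsLinearMap ℂ Φ) (hCP : IsCompletelyPositive Φ)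
    (hTP : ∀ M : Matrix (Fin d) (Fin d) ℂ, (Φ M).trace = M.trace) :
    Φ ((d : ℂ)⁻¹ • (1 : Matrix (Fin d) (Fin d) ℂ)) =
        (d : ℂ)⁻¹ • (1 : Matrix (Fin d) (Fin d) ℂ) ↔
      ∀ ρ : Matrix (Fin d) (Fin d) ℂ, IsDensityMatrix ρ → vN ρ ≤ vN (Φ ρ) := by
  rcases Nat.eq_zero_or_pos d with rfl | hd
  · exact ⟨fun _ ρ _ => by rw [Subsingleton.elim (Φ ρ) ρ], fun _ => Subsingleton.elim _ _⟩
  have hd' : (d : ℂ) ≠ 0 := by exact_mod_cast hd.ne'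
  constructor
  · intro h ρ hρ
    have hone : Φ 1 = 1 := by
      rw [hlin.map_smul] at h
      exact smul_right_injective _ (inv_ne_zero hd') h
    exact vN_le_of_unital hlin (fun _ => hCP.posSemidef) hTP hone hρ.1
  · intro h
    have hI : IsDensityMatrix ((d : ℂ)⁻¹ • (1 : Matrix (Fin d) (Fin d) ℂ)) :=
      ⟨Matrix.PosSemidef.one.smul (by positivity), by simp [hd']⟩
    exact eq_inv_smul_one_of_vN_le ⟨hCP.posSemidef hI.1, (hTP _).trans hI.2⟩ (h _ hI)
end

section
/- Let U be a unitary on ℂ^{d_s} ⊗ ℂ^{d_b}, let ρ_s be a density matrix on ℂ^{d_s} and ρ_b a density matrix on ℂ^{d_b}, and set ρ' = U(ρ_s ⊗ ρ_b)U†. Then S(Tr_b[ρ']) + S(Tr_s[ρ']) ≥ S(ρ_s) + S(ρ_b); that is, the sum of the entropies of the reduced states of system and bath cannot decrease under a unitary evolution applied to an initially uncorrelated product state. -/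
open scoped ComplexOrder Kronecker
open Matrix

/-- Partial trace over the second tensor factor. -/
noncomputable def ptraceSnd {a b : ℕ} (M : Matrix (Fin a × Fin b) (Fin a × Fin b) ℂ) :
    Matrix (Fin a) (Fin a) ℂ :=
  Matrix.of fun i j => ∑ k, M (i, k) (j, k)

/-- Partial trace over the first tensor factor. -/
noncomputable def ptraceFst {a b : ℕ} (M : Matrix (Fin a × Fin b) (Fin a × Fin b) ℂ) :
    Matrix (Fin b) (Fin b) ℂ :=
  Matrix.of fun i j => ∑ k, M (k, i) (k, j)

/-- Spectral decomposition of a Hermitian matrix, together with its entropy. -/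
lemma Matrix.IsHermitian.exists_unitary_diagonal_vN {d : ℕ} {ρ : Matrix (Fin d) (Fin d) ℂ}
    (h : ρ.IsHermitian) :
    ∃ V ∈ Matrix.unitaryGroup (Fin d) ℂ, ∃ e : Fin d → ℝ,
      ρ = V * diagonal (fun k => (e k : ℂ)) * Vᴴ ∧ vN ρ = ∑ k, Real.negMulLog (e k) ∧
        (ρ.PosSemidef → ∀ k, 0 ≤ e k) := by
  refine ⟨h.eigenvectorUnitary, h.eigenvectorUnitary.2, h.eigenvalues, ?_, ?_, ?_⟩
  · conv_lhs => rw [h.spectral_theorem]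
    rfl
  · simp [vN, h]
  · exact fun hp => hp.eigenvalues_nonneg

lemma ptraceSnd_isHermitian {a b : ℕ} {M : Matrix (Fin a × Fin b) (Fin a × Fin b) ℂ}
    (h : M.IsHermitian) : (ptraceSnd M).IsHermitian := by
  ext i j
  simp only [ptraceSnd, conjTranspose_apply, of_apply, star_sum]
  exact Finset.sum_congr rfl fun k _ => h.apply _ _

lemma ptraceFst_isHermitian {a b : ℕ} {M : Matrix (Fin a × Fin b) (Fin a × Fin b) ℂ}
    (h : M.IsHermitian) : (ptraceFst M).IsHermitian := by
  ext i j
  simp only [ptraceFst, conjTranspose_apply, of_apply, star_sum]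
  exact Finset.sum_congr rfl fun k _ => h.apply _ _

lemma ptraceSnd_kronecker_one_conj {a b : ℕ} (M : Matrix (Fin a × Fin b) (Fin a × Fin b) ℂ)
    (V V' : Matrix (Fin a) (Fin a) ℂ) :
    ptraceSnd ((V ⊗ₖ 1) * M * (V' ⊗ₖ 1)) = V * ptraceSnd M * V' := by
  ext i j
  simp only [ptraceSnd, of_apply, mul_apply, Fintype.sum_prod_type, kroneckerMap_apply,
    one_apply, mul_ite, mul_one, mul_zero, ite_mul, zero_mul, Finset.sum_ite_eq,
    Finset.sum_ite_eq', Finset.mem_univ, if_true, Finset.mul_sum, Finset.sum_mul]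
  rw [Finset.sum_comm]
  refine Finset.sum_congr rfl fun x _ => ?_
  rw [Finset.sum_comm]

lemma ptraceFst_one_kronecker_conj {a b : ℕ} (M : Matrix (Fin a × Fin b) (Fin a × Fin b) ℂ)
    (W W' : Matrix (Fin b) (Fin b) ℂ) :
    ptraceFst ((1 ⊗ₖ W) * M * (1 ⊗ₖ W')) = W * ptraceFst M * W' := by
  ext i j
  simp only [ptraceFst, of_apply, mul_apply, Fintype.sum_prod_type_right, kroneckerMap_apply,
    one_apply, mul_ite, one_mul, mul_zero, ite_mul, zero_mul, Finset.sum_ite_eq,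
    Finset.sum_ite_eq', Finset.mem_univ, if_true, Finset.mul_sum, Finset.sum_mul]
  rw [Finset.sum_comm]
  refine Finset.sum_congr rfl fun x _ => ?_
  rw [Finset.sum_comm]

/-- Conjugating by a unitary on the second factor does not change the partial trace over it. -/
lemma ptraceSnd_one_kronecker_conj {a b : ℕ} (M : Matrix (Fin a × Fin b) (Fin a × Fin b) ℂ)
    {W W' : Matrix (Fin b) (Fin b) ℂ} (h : W' * W = 1) :
    ptraceSnd ((1 ⊗ₖ W) * M * (1 ⊗ₖ W')) = ptraceSnd M := by
  ext i j
  have key (x y : Fin b) : ∑ k, W' y k * W k x = if y = x then 1 else 0 := by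
    rw [← mul_apply, h, one_apply]
  simp only [ptraceSnd, of_apply, mul_apply, Fintype.sum_prod_type_right, kroneckerMap_apply,
    one_apply, mul_ite, one_mul, mul_zero, ite_mul, zero_mul, Finset.sum_ite_eq,
    Finset.sum_ite_eq', Finset.mem_univ, if_true, Finset.sum_mul]
  calc ∑ k, ∑ y, ∑ x, W k x * M (i, x) (j, y) * W' y k
      = ∑ y, ∑ x, M (i, x) (j, y) * ∑ k, W' y k * W k x := by
        rw [Finset.sum_comm]
        refine Finset.sum_congr rfl fun y _ => ?_
        rw [Finset.sum_comm]
        refine Finset.sum_congr rfl fun x _ => ?_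
        rw [Finset.mul_sum]
        exact Finset.sum_congr rfl fun k _ => by ring
    _ = _ := by simp [key]

/-- Conjugating by a unitary on the first factor does not change the partial trace over it. -/
lemma ptraceFst_kronecker_one_conj {a b : ℕ} (M : Matrix (Fin a × Fin b) (Fin a × Fin b) ℂ)
    {V V' : Matrix (Fin a) (Fin a) ℂ} (h : V' * V = 1) :
    ptraceFst ((V ⊗ₖ 1) * M * (V' ⊗ₖ 1)) = ptraceFst M := by
  ext i j
  have key (x y : Fin a) : ∑ k, V' y k * V k x = if y = x then 1 else 0 := by
    rw [← mul_apply, h, one_apply]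
  simp only [ptraceFst, of_apply, mul_apply, Fintype.sum_prod_type, kroneckerMap_apply,
    one_apply, mul_ite, mul_one, mul_zero, ite_mul, zero_mul, Finset.sum_ite_eq,
    Finset.sum_ite_eq', Finset.mem_univ, if_true, Finset.sum_mul]
  calc ∑ k, ∑ y, ∑ x, V k x * M (x, i) (y, j) * V' y k
      = ∑ y, ∑ x, M (x, i) (y, j) * ∑ k, V' y k * V k x := by
        rw [Finset.sum_comm]
        refine Finset.sum_congr rfl fun y _ => ?_
        rw [Finset.sum_comm]
        refine Finset.sum_congr rfl fun x _ => ?_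
        rw [Finset.mul_sum]
        exact Finset.sum_congr rfl fun k _ => by ring
    _ = _ := by simp [key]

lemma kronecker_conj_eq {a b : ℕ} (M : Matrix (Fin a × Fin b) (Fin a × Fin b) ℂ)
    (V V' : Matrix (Fin a) (Fin a) ℂ) (W W' : Matrix (Fin b) (Fin b) ℂ) :
    (V ⊗ₖ W) * M * (V' ⊗ₖ W') = (V ⊗ₖ 1) * ((1 ⊗ₖ W) * M * (1 ⊗ₖ W')) * (V' ⊗ₖ 1) ∧
    (V ⊗ₖ W) * M * (V' ⊗ₖ W') = (1 ⊗ₖ W) * ((V ⊗ₖ 1) * M * (V' ⊗ₖ 1)) * (1 ⊗ₖ W') := by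
  have e₁ : V ⊗ₖ W = (V ⊗ₖ 1) * (1 ⊗ₖ W) := by rw [← mul_kronecker_mul]; simp
  have e₂ : V ⊗ₖ W = (1 ⊗ₖ W) * (V ⊗ₖ 1) := by rw [← mul_kronecker_mul]; simp
  have e₃ : V' ⊗ₖ W' = (V' ⊗ₖ 1) * (1 ⊗ₖ W') := by rw [← mul_kronecker_mul]; simp
  have e₄ : V' ⊗ₖ W' = (1 ⊗ₖ W') * (V' ⊗ₖ 1) := by rw [← mul_kronecker_mul]; simp
  constructor
  · rw [e₁, e₄]; simp only [Matrix.mul_assoc]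
  · rw [e₂, e₃]; simp only [Matrix.mul_assoc]

/-- Shannon entropy does not decrease under a doubly stochastic map. -/
lemma sum_negMulLog_le_of_doublyStochastic {ι : Type*} [Fintype ι] (T : ι → ι → ℝ)
    (hT : ∀ y x, 0 ≤ T y x) (hrow : ∀ y, ∑ x, T y x = 1) (hcol : ∀ x, ∑ y, T y x = 1)
    (π : ι → ℝ) (hπ : ∀ x, 0 ≤ π x) :
    ∑ x, Real.negMulLog (π x) ≤ ∑ y, Real.negMulLog (∑ x, T y x * π x) := by
  calc ∑ x, Real.negMulLog (π x) = ∑ y, ∑ x, T y x * Real.negMulLog (π x) := by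
        rw [Finset.sum_comm]
        simp [← Finset.sum_mul, hcol]
    _ ≤ _ := Finset.sum_le_sum fun y _ => by
        simpa using Real.concaveOn_negMulLog.le_map_sum (t := Finset.univ) (w := T y) (p := π)
          (fun x _ => hT y x) (hrow y) (fun x _ => hπ x)

/-- Subadditivity of the Shannon entropy. -/
lemma sum_negMulLog_le_marginals {ι κ : Type*} [Fintype ι] [Fintype κ] (r : ι → κ → ℝ)
    (hr : ∀ i j, 0 ≤ r i j) (hsum : ∑ i, ∑ j, r i j = 1) :
    ∑ i, ∑ j, Real.negMulLog (r i j) ≤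
      ∑ i, Real.negMulLog (∑ j, r i j) + ∑ j, Real.negMulLog (∑ i, r i j) := by
  set α : ι → ℝ := fun i => ∑ j, r i j with hα
  set β : κ → ℝ := fun j => ∑ i, r i j with hβ
  have hαr (i j) : r i j ≤ α i := Finset.single_le_sum (fun k _ => hr i k) (Finset.mem_univ j)
  have hβr (i j) : r i j ≤ β j :=
    Finset.single_le_sum (f := fun k => r k j) (fun k _ => hr k j) (Finset.mem_univ i)
  have hpt (i j) : Real.negMulLog (r i j) ≤
      α i * β j - r i j - r i j * Real.log (α i) - r i j * Real.log (β j) := by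
    rcases (hr i j).eq_or_lt with h | h
    · have := mul_nonneg ((hr i j).trans (hαr i j)) ((hr i j).trans (hβr i j))
      simpa [← h] using this
    · have ha := h.trans_le (hαr i j)
      have hb := h.trans_le (hβr i j)
      have hlog := Real.log_le_sub_one_of_pos (div_pos (mul_pos ha hb) h)
      rw [Real.log_div (mul_pos ha hb).ne' h.ne', Real.log_mul ha.ne' hb.ne'] at hlog
      have hmul := mul_le_mul_of_nonneg_left hlog h.le
      have hcancel : r i j * (α i * β j / r i j - 1) = α i * β j - r i j := by
        field_simp
      rw [Real.negMulLog]
      linarith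
  have hα1 : ∑ i, α i = 1 := hsum
  have hβ1 : ∑ j, β j = 1 := by rw [← hsum, Finset.sum_comm]
  have h₁ : ∑ i, ∑ j, α i * β j = 1 := by
    rw [← Finset.sum_mul_sum, hα1, hβ1, one_mul]
  have h₂ : ∑ i, ∑ j, r i j * Real.log (α i) = - ∑ i, Real.negMulLog (α i) := by
    simp [← Finset.sum_mul, Real.negMulLog, hα]
  have h₃ : ∑ i, ∑ j, r i j * Real.log (β j) = - ∑ j, Real.negMulLog (β j) := by
    rw [Finset.sum_comm]
    simp [← Finset.sum_mul, Real.negMulLog, hβ]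
  have hle := Finset.sum_le_sum fun i (_ : i ∈ Finset.univ) =>
    Finset.sum_le_sum fun j (_ : j ∈ Finset.univ) => hpt i j
  simp only [Finset.sum_sub_distrib, h₁, h₂, h₃] at hle
  linarith

/-- Additivity of the Shannon entropy on product distributions. -/
lemma sum_negMulLog_mul {ι κ : Type*} [Fintype ι] [Fintype κ] (p : ι → ℝ) (q : κ → ℝ)
    (hp : ∑ i, p i = 1) (hq : ∑ j, q j = 1) :
    ∑ x : ι × κ, Real.negMulLog (p x.1 * q x.2) =
      ∑ i, Real.negMulLog (p i) + ∑ j, Real.negMulLog (q j) := by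
  simp only [Real.negMulLog_mul, Fintype.sum_prod_type, Finset.sum_add_distrib,
    ← Finset.sum_mul, ← Finset.mul_sum, hp, hq, one_mul]

lemma sum_normSq_row_of_mem_unitaryGroup {ι : Type*} [Fintype ι] [DecidableEq ι]
    {X : Matrix ι ι ℂ} (hX : X ∈ Matrix.unitaryGroup ι ℂ) (y : ι) :
    ∑ x, Complex.normSq (X y x) = 1 := by
  have h := congrFun (congrFun (Matrix.mem_unitaryGroup_iff.1 hX) y) y
  rw [star_eq_conjTranspose, mul_apply, one_apply_eq] at h
  simp only [conjTranspose_apply, Complex.star_def, Complex.mul_conj] at h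
  exact_mod_cast h

lemma sum_normSq_col_of_mem_unitaryGroup {ι : Type*} [Fintype ι] [DecidableEq ι]
    {X : Matrix ι ι ℂ} (hX : X ∈ Matrix.unitaryGroup ι ℂ) (x : ι) :
    ∑ y, Complex.normSq (X y x) = 1 := by
  simpa [star_eq_conjTranspose, conjTranspose_apply] using
    sum_normSq_row_of_mem_unitaryGroup (Unitary.star_mem hX) x

lemma mul_diagonal_mul_conjTranspose_apply_self {ι : Type*} [Fintype ι] [DecidableEq ι]
    (X : Matrix ι ι ℂ) (π : ι → ℝ) (y : ι) :
    (X * diagonal (fun x => (π x : ℂ)) * Xᴴ) y y =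
      ((∑ x, Complex.normSq (X y x) * π x : ℝ) : ℂ) := by
  simp only [mul_apply (M := X * _), mul_diagonal, conjTranspose_apply, Complex.star_def]
  push_cast
  refine Finset.sum_congr rfl fun x _ => ?_
  rw [← Complex.mul_conj]
  ring

lemma sum_eq_one_of_trace {d : ℕ} {ρ V : Matrix (Fin d) (Fin d) ℂ} {e : Fin d → ℝ}
    (hV : V ∈ Matrix.unitaryGroup (Fin d) ℂ)
    (h : ρ = V * diagonal (fun k => (e k : ℂ)) * Vᴴ) (hρ : ρ.trace = 1) : ∑ k, e k = 1 := by
  have hV' : Vᴴ * V = 1 := Matrix.mem_unitaryGroup_iff'.1 hV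
  rw [h, trace_mul_comm, ← Matrix.mul_assoc, hV', Matrix.one_mul, trace_diagonal] at hρ
  exact_mod_cast hρ

/-- The sum of the entropies of the reduced states of system and bath cannot
decrease under a unitary evolution applied to an initially uncorrelated product
state. -/
theorem entropy_sum_nondecreasing_under_unitary {ds db : ℕ}
    (U : Matrix (Fin ds × Fin db) (Fin ds × Fin db) ℂ)
    (hU : U ∈ Matrix.unitaryGroup (Fin ds × Fin db) ℂ)
    (ρs : Matrix (Fin ds) (Fin ds) ℂ) (hρs : IsDensityMatrix ρs)
    (ρb : Matrix (Fin db) (Fin db) ℂ) (hρb : IsDensityMatrix ρb) :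
    vN ρs + vN ρb ≤
      vN (ptraceSnd (U * (ρs ⊗ₖ ρb) * Uᴴ)) + vN (ptraceFst (U * (ρs ⊗ₖ ρb) * Uᴴ)) := by
  obtain ⟨P, hP, p, hp, hSp, hp0⟩ := hρs.1.isHermitian.exists_unitary_diagonal_vN
  obtain ⟨Q, hQ, q, hq, hSq, hq0⟩ := hρb.1.isHermitian.exists_unitary_diagonal_vN
  have hp1 := sum_eq_one_of_trace hP hp hρs.2
  have hq1 := sum_eq_one_of_trace hQ hq hρb.2
  set R := U * (ρs ⊗ₖ ρb) * Uᴴ with hR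
  have hRh : R.IsHermitian := isHermitian_mul_mul_conjTranspose U
    (hρs.1.kronecker hρb.1).isHermitian
  obtain ⟨V, hV, α, hα, hSα, -⟩ := (ptraceSnd_isHermitian hRh).exists_unitary_diagonal_vN
  obtain ⟨W, hW, β, hβ, hSβ, -⟩ := (ptraceFst_isHermitian hRh).exists_unitary_diagonal_vN
  have hV' : Vᴴ * V = 1 := Matrix.mem_unitaryGroup_iff'.1 hV
  have hW' : Wᴴ * W = 1 := Matrix.mem_unitaryGroup_iff'.1 hW
  have hVV : V * Vᴴ = 1 := Matrix.mem_unitaryGroup_iff.1 hV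
  have hWW : W * Wᴴ = 1 := Matrix.mem_unitaryGroup_iff.1 hW
  set X := (Vᴴ ⊗ₖ Wᴴ) * U * (P ⊗ₖ Q) with hXdef
  have hX : X ∈ Matrix.unitaryGroup (Fin ds × Fin db) ℂ :=
    mul_mem (mul_mem (kronecker_mem_unitary (Unitary.star_mem hV) (Unitary.star_mem hW)) hU)
      (kronecker_mem_unitary hP hQ)
  set N := (Vᴴ ⊗ₖ Wᴴ) * R * (V ⊗ₖ W) with hN
  have hNX : N = X * diagonal (fun x => ((p x.1 * q x.2 : ℝ) : ℂ)) * Xᴴ := by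
    have hD : diagonal (fun x : Fin ds × Fin db => ((p x.1 * q x.2 : ℝ) : ℂ)) =
        diagonal (fun k => (p k : ℂ)) ⊗ₖ diagonal (fun k => (q k : ℂ)) := by
      rw [diagonal_kronecker_diagonal]
      simp
    rw [hN, hR, hp, hq, mul_kronecker_mul, mul_kronecker_mul, hD, hXdef]
    simp only [conjTranspose_mul, conjTranspose_kronecker, conjTranspose_conjTranspose,
      Matrix.mul_assoc]
  have hNα : ptraceSnd N = diagonal (fun k => (α k : ℂ)) := by
    rw [hN, (kronecker_conj_eq R _ _ _ _).1, ptraceSnd_kronecker_one_conj,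
      ptraceSnd_one_kronecker_conj R hWW, hα]
    simp only [← Matrix.mul_assoc, hV', Matrix.one_mul]
    rw [Matrix.mul_assoc, hV', Matrix.mul_one]
  have hNβ : ptraceFst N = diagonal (fun k => (β k : ℂ)) := by
    rw [hN, (kronecker_conj_eq R _ _ _ _).2, ptraceFst_one_kronecker_conj,
      ptraceFst_kronecker_one_conj R hVV, hβ]
    simp only [← Matrix.mul_assoc, hW', Matrix.one_mul]
    rw [Matrix.mul_assoc, hW', Matrix.mul_one]
  set T : Fin ds × Fin db → Fin ds × Fin db → ℝ := fun y x => Complex.normSq (X y x) with hT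
  have hT0 (y x) : 0 ≤ T y x := Complex.normSq_nonneg _
  have hcol (x) : ∑ y, T y x = 1 := sum_normSq_col_of_mem_unitaryGroup hX x
  have hπ0 (x : Fin ds × Fin db) : 0 ≤ p x.1 * q x.2 :=
    mul_nonneg (hp0 hρs.1 _) (hq0 hρb.1 _)
  set r : Fin ds × Fin db → ℝ := fun y => ∑ x, T y x * (p x.1 * q x.2) with hr
  have hNr (y) : N y y = (r y : ℂ) := by
    rw [hNX, mul_diagonal_mul_conjTranspose_apply_self]
  have hrα (i) : ∑ j, r (i, j) = α i := by
    have h := congrFun (congrFun hNα i) i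
    simp only [ptraceSnd, of_apply, hNr, diagonal_apply_eq] at h
    exact_mod_cast h
  have hrβ (j) : ∑ i, r (i, j) = β j := by
    have h := congrFun (congrFun hNβ j) j
    simp only [ptraceFst, of_apply, hNr, diagonal_apply_eq] at h
    exact_mod_cast h
  have hr1 : ∑ i, ∑ j, r (i, j) = 1 := by
    rw [← Fintype.sum_prod_type, hr, Finset.sum_comm]
    simp only [← Finset.sum_mul, hcol, one_mul]
    rw [Fintype.sum_prod_type, ← Finset.sum_mul_sum, hp1, hq1, one_mul]
  rw [hSp, hSq, hSα, hSβ, ← sum_negMulLog_mul p q hp1 hq1]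
  refine (sum_negMulLog_le_of_doublyStochastic T hT0
    (sum_normSq_row_of_mem_unitaryGroup hX) hcol _ hπ0).trans ?_
  rw [Fintype.sum_prod_type]
  have hsub := sum_negMulLog_le_marginals (fun i j => r (i, j))
    (fun i j => Finset.sum_nonneg fun x _ => mul_nonneg (hT0 _ _) (hπ0 x)) hr1
  simpa only [hrα, hrβ] using hsub
end

section
/- Let V be a unitary on ℂ^{d_t} ⊗ ℂ^{d_z}, let ρ be a density matrix on ℂ^{d_t} and σ a density matrix on ℂ^{d_z}, and suppose the implementation is catalytic at ρ, i.e. Tr_t[V(ρ ⊗ σ)V†] = σ. Then S(Tr_z[V(ρ ⊗ σ)V†]) ≥ S(ρ): a catalytic implementation of a channel cannot decrease the entropy of the state it acts on. -/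
open scoped ComplexOrder Kronecker
open Matrix

/-- Partial trace over the second (catalyst) tensor factor. -/
noncomputable def ptraceZ {a b : ℕ} (M : Matrix (Fin a × Fin b) (Fin a × Fin b) ℂ) :
    Matrix (Fin a) (Fin a) ℂ :=
  Matrix.of fun i j => ∑ k, M (i, k) (j, k)

/-- Partial trace over the first (target) tensor factor. -/
noncomputable def ptraceT {a b : ℕ} (M : Matrix (Fin a × Fin b) (Fin a × Fin b) ℂ) :
    Matrix (Fin b) (Fin b) ℂ :=
  Matrix.of fun i j => ∑ k, M (k, i) (k, j)

/-- Concavity of `negMulLog` under a doubly stochastic matrix. -/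
theorem sum_negMulLog_le_of_doublyStochastic_s5 {n : Type*} [Fintype n]
    (D : n → n → ℝ) (hD : ∀ i j, 0 ≤ D i j) (hrow : ∀ i, ∑ j, D i j = 1)
    (hcol : ∀ j, ∑ i, D i j = 1) (q : n → ℝ) (hq : ∀ j, 0 ≤ q j) :
    ∑ j, Real.negMulLog (q j) ≤ ∑ i, Real.negMulLog (∑ j, D i j * q j) := by
  calc ∑ j, Real.negMulLog (q j) = ∑ j, (∑ i, D i j) * Real.negMulLog (q j) := by simp [hcol]
    _ = ∑ i, ∑ j, D i j * Real.negMulLog (q j) := by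
        simp_rw [Finset.sum_mul]
        exact Finset.sum_comm
    _ ≤ _ := by
        refine Finset.sum_le_sum fun i _ => ?_
        simpa using Real.concaveOn_negMulLog.le_map_sum (t := Finset.univ) (w := D i) (p := q)
          (fun j _ => hD i j) (hrow i) (fun j _ => hq j)

/-- Subadditivity of the Shannon entropy of a joint distribution. -/
theorem sum_negMulLog_le_marginals_s5 {m n : Type*} [Fintype m] [Fintype n]
    (p : m → n → ℝ) (hp : ∀ i k, 0 ≤ p i k) (hsum : ∑ i, ∑ k, p i k = 1) :
    ∑ i, ∑ k, Real.negMulLog (p i k) ≤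
      ∑ i, Real.negMulLog (∑ k, p i k) + ∑ k, Real.negMulLog (∑ i, p i k) := by
  set a : m → ℝ := fun i => ∑ k, p i k with ha
  set b : n → ℝ := fun k => ∑ i, p i k with hb
  have hsum_a : ∑ i, ∑ k, p i k = 1 := hsum
  have hsum' : ∑ k, b k = 1 := by rw [← hsum, Finset.sum_comm]
  have key : ∀ i k, Real.negMulLog (p i k) ≤
      -(p i k * Real.log (a i)) - p i k * Real.log (b k) + (a i * b k - p i k) := by
    intro i k
    have hpa : p i k ≤ a i :=
      Finset.single_le_sum (f := fun k => p i k) (fun k _ => hp i k) (Finset.mem_univ k)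
    have hpb : p i k ≤ b k :=
      Finset.single_le_sum (f := fun i => p i k) (fun i _ => hp i k) (Finset.mem_univ i)
    rcases (hp i k).eq_or_lt with h | h
    · rw [← h] at hpa hpb ⊢
      simpa using mul_nonneg hpa hpb
    · have h1 := h.trans_le hpa
      have h2 := h.trans_le hpb
      have hlog := Real.log_le_sub_one_of_pos (div_pos (mul_pos h1 h2) h)
      rw [Real.log_div (mul_pos h1 h2).ne' h.ne', Real.log_mul h1.ne' h2.ne'] at hlog
      have hmul := mul_le_mul_of_nonneg_left hlog h.le
      have hdiv : p i k * (a i * b k / p i k - 1) = a i * b k - p i k := by field_simp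
      rw [hdiv] at hmul
      rw [Real.negMulLog]
      linarith
  refine (Finset.sum_le_sum fun i _ => Finset.sum_le_sum fun k _ => key i k).trans (le_of_eq ?_)
  have e1 : ∑ i, ∑ k, p i k * Real.log (a i) = -∑ i, Real.negMulLog (a i) := by
    simp [Real.negMulLog, ← Finset.sum_mul, ha]
  have e2 : ∑ i, ∑ k, p i k * Real.log (b k) = -∑ k, Real.negMulLog (b k) := by
    rw [Finset.sum_comm]
    simp [Real.negMulLog, ← Finset.sum_mul, hb]
  have e3 : ∑ i, ∑ k, a i * b k = 1 := by
    simp_rw [← Finset.mul_sum, hsum', mul_one]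
    exact hsum
  simp only [Finset.sum_add_distrib, Finset.sum_sub_distrib, Finset.sum_neg_distrib, e1, e2, e3,
    hsum_a]
  simp only [ha, hb]
  ring

/-- Additivity of the Shannon entropy on product distributions. -/
theorem sum_negMulLog_mul_s5 {m n : Type*} [Fintype m] [Fintype n] (r : m → ℝ) (s : n → ℝ)
    (hr : ∑ i, r i = 1) (hs : ∑ k, s k = 1) :
    ∑ x : m × n, Real.negMulLog (r x.1 * s x.2) =
      ∑ i, Real.negMulLog (r i) + ∑ k, Real.negMulLog (s k) := by
  simp_rw [Fintype.sum_prod_type, Real.negMulLog_mul, Finset.sum_add_distrib, ← Finset.sum_mul,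
    ← Finset.mul_sum, ← Finset.sum_mul]
  simp [hs, hr]

theorem ptraceZ_kronecker_conj {a b : ℕ} (M : Matrix (Fin a × Fin b) (Fin a × Fin b) ℂ)
    (X : Matrix (Fin a) (Fin a) ℂ) (Y : Matrix (Fin b) (Fin b) ℂ) (hY : Y * Yᴴ = 1) :
    ptraceZ ((X ⊗ₖ Y)ᴴ * M * (X ⊗ₖ Y)) = Xᴴ * ptraceZ M * X := by
  have hleft : ∀ (N : Matrix (Fin a × Fin b) (Fin a × Fin b) ℂ) (Z : Matrix (Fin a) (Fin a) ℂ),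
      ptraceZ ((Z ⊗ₖ (1 : Matrix (Fin b) (Fin b) ℂ)) * N) = Z * ptraceZ N := by
    intro N Z
    ext i j
    simp only [ptraceZ, of_apply, mul_apply, Fintype.sum_prod_type, kroneckerMap_apply, one_apply,
      mul_ite, mul_one, mul_zero, ite_mul, zero_mul, Finset.sum_ite_eq, Finset.mem_univ, if_true,
      Finset.mul_sum]
    exact Finset.sum_comm
  have hright : ∀ (N : Matrix (Fin a × Fin b) (Fin a × Fin b) ℂ) (Z : Matrix (Fin a) (Fin a) ℂ),
      ptraceZ (N * (Z ⊗ₖ (1 : Matrix (Fin b) (Fin b) ℂ))) = ptraceZ N * Z := by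
    intro N Z
    ext i j
    simp only [ptraceZ, of_apply, mul_apply, Fintype.sum_prod_type, kroneckerMap_apply, one_apply,
      mul_ite, mul_one, mul_zero, Finset.sum_ite_eq', Finset.mem_univ, if_true,
      Finset.sum_mul]
    exact Finset.sum_comm
  have hcyc : ∀ (N : Matrix (Fin a × Fin b) (Fin a × Fin b) ℂ) (Z : Matrix (Fin b) (Fin b) ℂ),
      ptraceZ (((1 : Matrix (Fin a) (Fin a) ℂ) ⊗ₖ Z) * N) =
        ptraceZ (N * ((1 : Matrix (Fin a) (Fin a) ℂ) ⊗ₖ Z)) := by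
    intro N Z
    ext i j
    simp only [ptraceZ, of_apply, mul_apply, Fintype.sum_prod_type_right, kroneckerMap_apply,
      one_apply, ite_mul, one_mul, zero_mul, mul_ite, mul_zero, Finset.sum_ite_eq,
      Finset.sum_ite_eq', Finset.mem_univ, if_true]
    rw [Finset.sum_comm]
    simp_rw [mul_comm]
  have e1 : (X ⊗ₖ Y)ᴴ = ((1 : Matrix (Fin a) (Fin a) ℂ) ⊗ₖ Yᴴ) *
      (Xᴴ ⊗ₖ (1 : Matrix (Fin b) (Fin b) ℂ)) := by
    rw [← mul_kronecker_mul, conjTranspose_kronecker]; simp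
  have e2 : (X ⊗ₖ Y) * ((1 : Matrix (Fin a) (Fin a) ℂ) ⊗ₖ Yᴴ) =
      X ⊗ₖ (1 : Matrix (Fin b) (Fin b) ℂ) := by
    rw [← mul_kronecker_mul, hY, mul_one]
  rw [e1, Matrix.mul_assoc, Matrix.mul_assoc, hcyc, Matrix.mul_assoc, Matrix.mul_assoc, e2, hleft,
    hright, Matrix.mul_assoc]

theorem ptraceT_eq_ptraceZ_submatrix {a b : ℕ}
    (M : Matrix (Fin a × Fin b) (Fin a × Fin b) ℂ) :
    ptraceT M = ptraceZ (M.submatrix Prod.swap Prod.swap) := rfl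

theorem ptraceT_kronecker_conj {a b : ℕ} (M : Matrix (Fin a × Fin b) (Fin a × Fin b) ℂ)
    (X : Matrix (Fin a) (Fin a) ℂ) (Y : Matrix (Fin b) (Fin b) ℂ) (hX : X * Xᴴ = 1) :
    ptraceT ((X ⊗ₖ Y)ᴴ * M * (X ⊗ₖ Y)) = Yᴴ * ptraceT M * Y := by
  have hswap : (X ⊗ₖ Y).submatrix Prod.swap Prod.swap = Y ⊗ₖ X := by
    ext i j
    simp [mul_comm]
  rw [ptraceT_eq_ptraceZ_submatrix, ptraceT_eq_ptraceZ_submatrix, ← ptraceZ_kronecker_conj _ _ _ hX,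
    ← hswap, conjTranspose_submatrix]
  congr 1
  change _ = _ * M.submatrix (Equiv.prodComm _ _) (Equiv.prodComm _ _) * _
  rw [← Equiv.coe_prodComm, submatrix_mul_equiv, submatrix_mul_equiv]

theorem ptraceZ_isHermitian {a b : ℕ} {M : Matrix (Fin a × Fin b) (Fin a × Fin b) ℂ}
    (hM : M.IsHermitian) : (ptraceZ M).IsHermitian := by
  ext i j
  simp [ptraceZ, conjTranspose_apply, fun k => hM.apply (i, k) (j, k)]

/-- The diagonal of a unitary conjugate of a real diagonal matrix. -/
theorem conj_diagonal_apply_self {n : Type*} [Fintype n] [DecidableEq n]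
    (Q : Matrix n n ℂ) (q : n → ℝ) (x : n) :
    (Q * diagonal (fun y => (q y : ℂ)) * Qᴴ) x x = ((∑ y, ‖Q x y‖ ^ 2 * q y : ℝ) : ℂ) := by
  rw [mul_apply]
  simp only [mul_diagonal, conjTranspose_apply]
  push_cast
  refine Finset.sum_congr rfl fun y _ => ?_
  rw [mul_right_comm, RCLike.star_def, Complex.mul_conj']

theorem sum_norm_sq_row {n : Type*} [Fintype n] [DecidableEq n] {Q : Matrix n n ℂ}
    (hQ : Q * Qᴴ = 1) (x : n) : ∑ y, ‖Q x y‖ ^ 2 = 1 := by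
  have h := conj_diagonal_apply_self Q (fun _ => 1) x
  simp only [Complex.ofReal_one, diagonal_one, mul_one, hQ, one_apply_eq] at h
  exact_mod_cast h.symm

theorem conjTranspose_mul_eigenvectorUnitary {d : ℕ} {A : Matrix (Fin d) (Fin d) ℂ}
    (hA : A.IsHermitian) :
    (hA.eigenvectorUnitary : Matrix (Fin d) (Fin d) ℂ)ᴴ * A * hA.eigenvectorUnitary =
      diagonal (fun i => (hA.eigenvalues i : ℂ)) := by
  have h := hA.conjStarAlgAut_star_eigenvectorUnitary
  simpa [Unitary.conjStarAlgAut_apply, star_eq_conjTranspose, Function.comp_def] using h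

theorem IsDensityMatrix.sum_eigenvalues {d : ℕ} {A : Matrix (Fin d) (Fin d) ℂ}
    (h : IsDensityMatrix A) : ∑ i, h.1.isHermitian.eigenvalues i = 1 := by
  have hsum := h.2.symm.trans h.1.isHermitian.trace_eq_sum_eigenvalues
  exact Complex.ofReal_injective (by simpa using hsum.symm)

/-- A catalytic implementation of a channel (the catalyst `σ` is returned
unchanged) cannot decrease the entropy of the state it acts on. -/
theorem catalytic_channel_entropy_nondecreasing {dt dz : ℕ}
    (V : Matrix (Fin dt × Fin dz) (Fin dt × Fin dz) ℂ)
    (hV : V ∈ Matrix.unitaryGroup (Fin dt × Fin dz) ℂ)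
    (ρ : Matrix (Fin dt) (Fin dt) ℂ) (hρ : IsDensityMatrix ρ)
    (σ : Matrix (Fin dz) (Fin dz) ℂ) (hσ : IsDensityMatrix σ)
    (hcat : ptraceT (V * (ρ ⊗ₖ σ) * Vᴴ) = σ) :
    vN ρ ≤ vN (ptraceZ (V * (ρ ⊗ₖ σ) * Vᴴ)) := by
  have hr := hρ.1.isHermitian
  have hs := hσ.1.isHermitian
  set M := V * (ρ ⊗ₖ σ) * Vᴴ with hM
  have hMh : M.IsHermitian := isHermitian_mul_mul_conjTranspose V (by
    rw [IsHermitian, conjTranspose_kronecker, hr.eq, hs.eq])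
  have hA := ptraceZ_isHermitian hMh
  rw [vN, vN, dif_pos hr, dif_pos hA]
  set R := hr.eigenvectorUnitary with hR
  set S := hs.eigenvectorUnitary with hS
  set T := hA.eigenvectorUnitary with hT
  have unit : ∀ {d : ℕ} (U : unitaryGroup (Fin d) ℂ),
      (U : Matrix (Fin d) (Fin d) ℂ) * (U : Matrix (Fin d) (Fin d) ℂ)ᴴ = 1 :=
    fun U => mem_unitaryGroup_iff.mp U.2
  set q : Fin dt × Fin dz → ℝ := fun x => hr.eigenvalues x.1 * hs.eigenvalues x.2 with hq
  set W := (T : Matrix (Fin dt) (Fin dt) ℂ) ⊗ₖ (S : Matrix (Fin dz) (Fin dz) ℂ) with hW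
  set P := (R : Matrix (Fin dt) (Fin dt) ℂ) ⊗ₖ (S : Matrix (Fin dz) (Fin dz) ℂ) with hP
  have hWu : W ∈ unitaryGroup (Fin dt × Fin dz) ℂ := kronecker_mem_unitary T.2 S.2
  have hPu : P ∈ unitaryGroup (Fin dt × Fin dz) ℂ := kronecker_mem_unitary R.2 S.2
  have hPP : P * Pᴴ = 1 := mem_unitaryGroup_iff.mp hPu
  set Q := Wᴴ * V * P with hQdef
  have hQ : Q ∈ unitaryGroup (Fin dt × Fin dz) ℂ :=
    mul_mem (mul_mem (Unitary.star_mem hWu) hV) hPu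
  have hQ1 : Q * Qᴴ = 1 := mem_unitaryGroup_iff.mp hQ
  have hQ2 : Qᴴ * Q = 1 := mem_unitaryGroup_iff'.mp hQ
  have hdiag : Pᴴ * (ρ ⊗ₖ σ) * P = diagonal (fun x => (q x : ℂ)) := by
    rw [hP, conjTranspose_kronecker, ← mul_kronecker_mul, ← mul_kronecker_mul,
      conjTranspose_mul_eigenvectorUnitary, conjTranspose_mul_eigenvectorUnitary,
      diagonal_kronecker_diagonal]
    simp [hq]
  have hN : Wᴴ * M * W = Q * diagonal (fun x => (q x : ℂ)) * Qᴴ := by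
    rw [← hdiag]
    calc Wᴴ * M * W = Wᴴ * V * 1 * (ρ ⊗ₖ σ) * 1 * Vᴴ * W := by
          simp only [hM, Matrix.mul_assoc, Matrix.one_mul]
      _ = _ := by
          rw [← hPP]
          simp only [hQdef, conjTranspose_mul, conjTranspose_conjTranspose, Matrix.mul_assoc]
  set p : Fin dt → Fin dz → ℝ := fun i k => ∑ y, ‖Q (i, k) y‖ ^ 2 * q y with hp
  have hNp : ∀ i k, (Wᴴ * M * W) (i, k) (i, k) = (p i k : ℂ) := fun i k => by
    rw [hN, conj_diagonal_apply_self]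
  have hpa : ∀ i, ∑ k, p i k = hA.eigenvalues i := fun i => by
    have h := congrFun₂ (ptraceZ_kronecker_conj M T S (unit S)) i i
    rw [conjTranspose_mul_eigenvectorUnitary, diagonal_apply_eq, ptraceZ, of_apply] at h
    simp only [← hW, hNp] at h
    exact_mod_cast h
  have hpb : ∀ k, ∑ i, p i k = hs.eigenvalues k := fun k => by
    have h := congrFun₂ (ptraceT_kronecker_conj M T S (unit T)) k k
    rw [hcat, conjTranspose_mul_eigenvectorUnitary, diagonal_apply_eq, ptraceT, of_apply] at h
    simp only [← hW, hNp] at h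
    exact_mod_cast h
  have hq0 : ∀ x, 0 ≤ q x := fun x =>
    mul_nonneg (hρ.1.eigenvalues_nonneg _) (hσ.1.eigenvalues_nonneg _)
  have hp0 : ∀ i k, 0 ≤ p i k := fun i k =>
    Finset.sum_nonneg fun y _ => mul_nonneg (sq_nonneg _) (hq0 y)
  have hpsum : ∑ i, ∑ k, p i k = 1 := by
    rw [Finset.sum_comm]
    simp_rw [hpb]
    exact hσ.sum_eigenvalues
  have h1 := sum_negMulLog_mul_s5 _ _ hρ.sum_eigenvalues hσ.sum_eigenvalues
  have h2 := sum_negMulLog_le_of_doublyStochastic_s5 (fun x y => ‖Q x y‖ ^ 2)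
    (fun _ _ => sq_nonneg _) (sum_norm_sq_row hQ1)
    (fun y => by
      simpa [conjTranspose_apply] using
        sum_norm_sq_row (Q := Qᴴ) (by rwa [conjTranspose_conjTranspose]) y) q hq0
  have h3 := sum_negMulLog_le_marginals_s5 p hp0 hpsum
  simp_rw [hpa, hpb] at h3
  rw [Fintype.sum_prod_type (fun x => Real.negMulLog (∑ y, ‖Q x y‖ ^ 2 * q y))] at h2
  linarith
end

section
/- Every catalytic channel is unital: let V be a unitary on ℂ^{d} ⊗ ℂ^{d_z} and σ a density matrix on ℂ^{d_z} such that Tr_t[V((I/d) ⊗ σ)V†] = σ (the catalyst is returned unchanged when the channel acts on the maximally mixed state). Then Tr_z[V((I/d) ⊗ σ)V†] = I/d, i.e. the channel C(ρ) = Tr_z[V(ρ ⊗ σ)V†] maps the maximally mixed state to itself. -/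
open scoped ComplexOrder Kronecker
open Matrix

theorem trace_mul_one_kronecker {a b : ℕ} (M : Matrix (Fin a × Fin b) (Fin a × Fin b) ℂ)
    (B : Matrix (Fin b) (Fin b) ℂ) :
    (M * ((1 : Matrix (Fin a) (Fin a) ℂ) ⊗ₖ B)).trace = (ptraceT M * B).trace := by
  simp only [Matrix.trace, Matrix.diag_apply, Matrix.mul_apply, Fintype.sum_prod_type,
    Matrix.kroneckerMap_apply, Matrix.one_apply, ptraceT, Matrix.of_apply, Finset.sum_mul,
    ite_mul, one_mul, zero_mul, mul_ite, mul_zero]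
  simp only [Finset.sum_comm (s := (Finset.univ : Finset (Fin b)))
    (t := (Finset.univ : Finset (Fin a)))]
  refine Finset.sum_congr rfl fun x _ => ?_
  rw [Finset.sum_eq_single x (fun y _ hy => by simp [hy]) (by simp)]
  simp

theorem ptraceT_kronecker {a b : ℕ} (A : Matrix (Fin a) (Fin a) ℂ)
    (B : Matrix (Fin b) (Fin b) ℂ) : ptraceT (A ⊗ₖ B) = A.trace • B := by
  ext i j
  simp [ptraceT, Matrix.trace, Finset.sum_mul]

theorem ptraceZ_kronecker {a b : ℕ} (A : Matrix (Fin a) (Fin a) ℂ)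
    (B : Matrix (Fin b) (Fin b) ℂ) : ptraceZ (A ⊗ₖ B) = B.trace • A := by
  ext i j
  simp [ptraceZ, Matrix.trace, ← Finset.mul_sum, mul_comm]

/-- A Hermitian matrix unitarily conjugate to a Hermitian matrix `Y` and with the same
Hilbert-Schmidt overlap with `Y` as `Y` itself is equal to `Y`. -/
theorem unitary_conj_eq_self_of_trace_mul_eq {n : Type*} [Fintype n] [DecidableEq n]
    {V Y : Matrix n n ℂ} (hV : V ∈ Matrix.unitaryGroup n ℂ) (hY : Y.IsHermitian)
    (h : (V * Y * Vᴴ * Y).trace = (Y * Y).trace) : V * Y * Vᴴ = Y := by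
  have hVV : Vᴴ * V = 1 := Matrix.mem_unitaryGroup_iff'.mp hV
  have hX : (V * Y * Vᴴ).IsHermitian := Matrix.isHermitian_mul_mul_conjTranspose V hY
  have hXX : (V * Y * Vᴴ * (V * Y * Vᴴ)).trace = (Y * Y).trace := by
    have : V * Y * Vᴴ * (V * Y * Vᴴ) = V * (Y * Y * Vᴴ) := by
      calc _ = V * Y * (Vᴴ * V) * Y * Vᴴ := by simp only [Matrix.mul_assoc]
        _ = _ := by rw [hVV]; simp only [Matrix.mul_assoc, Matrix.mul_one]
    rw [this, Matrix.trace_mul_comm, Matrix.mul_assoc, hVV, Matrix.mul_one]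
  rw [← sub_eq_zero, ← Matrix.trace_conjTranspose_mul_self_eq_zero_iff, (hX.sub hY).eq,
    Matrix.sub_mul, Matrix.mul_sub, Matrix.mul_sub, Matrix.trace_sub, Matrix.trace_sub,
    Matrix.trace_sub, hXX, Matrix.trace_mul_comm Y (V * Y * Vᴴ), h]
  ring

/-- Every catalytic channel is unital: if the catalyst `σ` is returned unchanged
when the channel acts on the maximally mixed state `I/d`, then the output of the
channel on `I/d` is again `I/d`. -/
theorem catalytic_channel_is_unital {d dz : ℕ}
    (V : Matrix (Fin d × Fin dz) (Fin d × Fin dz) ℂ)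
    (hV : V ∈ Matrix.unitaryGroup (Fin d × Fin dz) ℂ)
    (σ : Matrix (Fin dz) (Fin dz) ℂ) (hσ : IsDensityMatrix σ)
    (hcat : ptraceT (V * (((d : ℂ)⁻¹ • (1 : Matrix (Fin d) (Fin d) ℂ)) ⊗ₖ σ) * Vᴴ) = σ) :
    ptraceZ (V * (((d : ℂ)⁻¹ • (1 : Matrix (Fin d) (Fin d) ℂ)) ⊗ₖ σ) * Vᴴ) =
      (d : ℂ)⁻¹ • (1 : Matrix (Fin d) (Fin d) ℂ) := by
  obtain rfl | hd := Nat.eq_zero_or_pos d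
  · ext i
    exact i.elim0
  have hd0 : (d : ℂ) ≠ 0 := Nat.cast_ne_zero.mpr hd.ne'
  have hY : (((d : ℂ)⁻¹ • (1 : Matrix (Fin d) (Fin d) ℂ)) ⊗ₖ σ).IsHermitian := by
    rw [Matrix.IsHermitian, Matrix.conjTranspose_kronecker, hσ.1.isHermitian.eq]
    simp
  have hT : ptraceT (((d : ℂ)⁻¹ • (1 : Matrix (Fin d) (Fin d) ℂ)) ⊗ₖ σ) = σ := by
    simp [ptraceT_kronecker, hd0]
  have overlap : ∀ M, (M * (((d : ℂ)⁻¹ • (1 : Matrix (Fin d) (Fin d) ℂ)) ⊗ₖ σ)).trace =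
      (d : ℂ)⁻¹ * (ptraceT M * σ).trace := fun M => by
    rw [Matrix.smul_kronecker, Matrix.mul_smul, Matrix.trace_smul, trace_mul_one_kronecker,
      smul_eq_mul]
  rw [unitary_conj_eq_self_of_trace_mul_eq hV hY (by rw [overlap, overlap, hcat, hT]),
    ptraceZ_kronecker, hσ.2, one_smul]
end

section
/- Let A, B, L be real numbers with L > 0 and |A − B| ≤ 2L, and let ψ_L : ℝ → ℝ be the normalized top-hat function ψ_L(x) = (2L)^{−1/2} for x ∈ [−L, L] and ψ_L(x) = 0 otherwise. Then ∫_ℝ x·ψ_L(x − A)·ψ_L(x − B) dx = (A + B)/2 − (A + B)|A − B|/(4L). -/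
open MeasureTheory

/-- The normalized top-hat wavefunction of half-width `L`:
`ψ_L(x) = (2L)^{-1/2}` on `[-L, L]` and `0` otherwise. -/
noncomputable def topHat (L x : ℝ) : ℝ :=
  if x ∈ Set.Icc (-L) L then (Real.sqrt (2 * L))⁻¹ else 0

/-- The product of two translated top-hats is supported on the overlap of their supports,
where it is constant. -/
theorem mul_topHat_sub_mul_topHat_sub (A B x : ℝ) {L : ℝ} (hL : 0 < L) :
    x * topHat L (x - A) * topHat L (x - B) =
      (Set.Icc (max A B - L) (min A B + L)).indicator (fun y => y * (2 * L)⁻¹) x := by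
  have hsq : (Real.sqrt (2 * L))⁻¹ * (Real.sqrt (2 * L))⁻¹ = (2 * L)⁻¹ := by
    rw [← mul_inv, Real.mul_self_sqrt (by positivity)]
  have hmem : x ∈ Set.Icc (max A B - L) (min A B + L) ↔
      x - A ∈ Set.Icc (-L) L ∧ x - B ∈ Set.Icc (-L) L := by
    simp only [Set.mem_Icc]
    grind
  by_cases hA : x - A ∈ Set.Icc (-L) L <;> by_cases hB : x - B ∈ Set.Icc (-L) L <;>
    simp only [topHat, Set.indicator, hmem, hA, hB, if_true, if_false, and_true, and_false,
      mul_assoc, hsq, mul_zero, zero_mul]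

/-- The shift of the average position of a top-hat weight state after
translations by `A` and `B` on the two sides of the density matrix:
`∫ x ψ_L(x-A) ψ_L(x-B) x dx = (A+B)/2 - (A+B)|A-B|/(4L)`. -/
theorem topHat_weight_average_position (A B L : ℝ) (hL : 0 < L)
    (hAB : |A - B| ≤ 2 * L) :
    ∫ x : ℝ, x * topHat L (x - A) * topHat L (x - B) =
      (A + B) / 2 - (A + B) * |A - B| / (4 * L) := by
  have hmax : max A B - L ≤ min A B + L := by
    linarith [max_sub_min_eq_abs' A B]
  simp_rw [mul_topHat_sub_mul_topHat_sub A B _ hL]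
  rw [integral_indicator measurableSet_Icc, integral_Icc_eq_integral_Ioc,
    ← intervalIntegral.integral_of_le hmax, intervalIntegral.integral_mul_const, integral_id]
  rcases le_total A B with h | h
  · rw [max_eq_right h, min_eq_left h, abs_of_nonpos (sub_nonpos.2 h)]
    field_simp
    ring
  · rw [max_eq_left h, min_eq_right h, abs_of_nonneg (sub_nonneg.2 h)]
    field_simp
    ring
end

section
/- Let A, B be fixed real numbers, and for L > 0 let τ_L : ℝ → ℝ be the normalized triangular function τ_L(x) = (3/L³)^{1/2}·(x + 3L/4) for x ∈ [−3L/4, L/4] and τ_L(x) = 0 otherwise. Then lim_{L→∞} ( ∫_ℝ x·τ_L(x − A)·τ_L(x − B) dx − (A + B)/2 ) = −3|A − B|/8. In particular, for A ≠ B this limit differs from the value 0 obtained for the symmetric top-hat weight state, so the conditional work benefit of applying a measurement depends on the initial state of the weight even in the broad-state limit. -/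
open MeasureTheory

/-- The normalized asymmetric triangular wavefunction:
`τ_L(x) = (3/L³)^{1/2} (x + 3L/4)` on `[-3L/4, L/4]` and `0` otherwise. -/
noncomputable def triWeight (L x : ℝ) : ℝ :=
  if x ∈ Set.Icc (-(3 * L / 4)) (L / 4) then
    Real.sqrt (3 / L ^ 3) * (x + 3 * L / 4) else 0

theorem integral_mul_add_mul_add (p q a b : ℝ) :
    ∫ x in a..b, x * (x + p) * (x + q) =
      (b ^ 4 / 4 + (p + q) * b ^ 3 / 3 + p * q * b ^ 2 / 2) -
        (a ^ 4 / 4 + (p + q) * a ^ 3 / 3 + p * q * a ^ 2 / 2) := by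
  refine intervalIntegral.integral_eq_sub_of_hasDerivAt
    (f := fun x : ℝ => x ^ 4 / 4 + (p + q) * x ^ 3 / 3 + p * q * x ^ 2 / 2) (fun x _ => ?_)
    (Continuous.intervalIntegrable (by fun_prop) _ _)
  refine HasDerivAt.congr_deriv (((((hasDerivAt_pow 4 x).div_const 4).add
    (((hasDerivAt_pow 3 x).const_mul (p + q)).div_const 3)).add
    (((hasDerivAt_pow 2 x).const_mul (p * q)).div_const 2))) ?_
  push_cast
  ring

/-- On the overlap of the two translated supports the integrand is a cubic polynomial. -/
theorem mul_triWeight_sub_mul_triWeight_sub {A B L : ℝ} (hAB : A ≤ B) (hL : 0 < L) (x : ℝ) :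
    x * triWeight L (x - A) * triWeight L (x - B) =
      (Set.Icc (B - 3 * L / 4) (A + L / 4)).indicator
        (fun x => 3 / L ^ 3 * (x * (x + (3 * L / 4 - A)) * (x + (3 * L / 4 - B)))) x := by
  have hs : Real.sqrt (3 / L ^ 3) * Real.sqrt (3 / L ^ 3) = 3 / L ^ 3 :=
    Real.mul_self_sqrt (by positivity)
  unfold triWeight
  by_cases hx : x ∈ Set.Icc (B - 3 * L / 4) (A + L / 4)
  · have hA : x - A ∈ Set.Icc (-(3 * L / 4)) (L / 4) :=
      ⟨by linarith [hx.1], by linarith [hx.2]⟩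
    have hB : x - B ∈ Set.Icc (-(3 * L / 4)) (L / 4) :=
      ⟨by linarith [hx.1], by linarith [hx.2]⟩
    rw [Set.indicator_of_mem hx, if_pos hA, if_pos hB]
    linear_combination x * (x + (3 * L / 4 - A)) * (x + (3 * L / 4 - B)) * hs
  · rw [Set.indicator_of_notMem hx]
    by_cases hA : x - A ∈ Set.Icc (-(3 * L / 4)) (L / 4)
    · have hB : x - B ∉ Set.Icc (-(3 * L / 4)) (L / 4) := fun hB =>
        hx ⟨by linarith [hB.1], by linarith [hA.2]⟩
      rw [if_neg hB, mul_zero]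
    · rw [if_neg hA, mul_zero, zero_mul]

theorem integral_mul_triWeight_sub_mul_triWeight_sub {A B L : ℝ} (hAB : A ≤ B) (hL : 0 < L)
    (hBL : B - A ≤ L) :
    ∫ x : ℝ, x * triWeight L (x - A) * triWeight L (x - B) =
      B - 7 * (B - A) / 8 + 3 * ((B - A) ^ 2 - B * (B - A)) / 2 * L⁻¹
        - 3 * (B - A) ^ 3 / 8 * L⁻¹ ^ 2
        + (B * (B - A) ^ 3 / 2 - (B - A) ^ 4 / 4) * L⁻¹ ^ 3 := by
  simp_rw [mul_triWeight_sub_mul_triWeight_sub hAB hL]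
  rw [integral_indicator measurableSet_Icc, integral_Icc_eq_integral_Ioc,
    ← intervalIntegral.integral_of_le (by linarith), intervalIntegral.integral_const_mul,
    integral_mul_add_mul_add]
  field_simp
  ring

theorem tendsto_integral_mul_triWeight_of_le {A B : ℝ} (hAB : A ≤ B) :
    Filter.Tendsto
      (fun L : ℝ =>
        (∫ x : ℝ, x * triWeight L (x - A) * triWeight L (x - B)) - (A + B) / 2)
      Filter.atTop (nhds (-(3 * |A - B|) / 8)) := by
  have hcont : Continuous fun u : ℝ =>
      B - 7 * (B - A) / 8 + 3 * ((B - A) ^ 2 - B * (B - A)) / 2 * u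
        - 3 * (B - A) ^ 3 / 8 * u ^ 2
        + (B * (B - A) ^ 3 / 2 - (B - A) ^ 4 / 4) * u ^ 3 - (A + B) / 2 := by fun_prop
  have hlim := (hcont.tendsto 0).comp (tendsto_inv_atTop_zero (𝕜 := ℝ))
  have hval : -(3 * |A - B|) / 8 = B - 7 * (B - A) / 8
      + 3 * ((B - A) ^ 2 - B * (B - A)) / 2 * 0 - 3 * (B - A) ^ 3 / 8 * 0 ^ 2
      + (B * (B - A) ^ 3 / 2 - (B - A) ^ 4 / 4) * 0 ^ 3 - (A + B) / 2 := by
    rw [abs_of_nonpos (sub_nonpos.2 hAB)]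
    ring
  rw [hval]
  refine hlim.congr' ?_
  filter_upwards [Filter.eventually_gt_atTop 0, Filter.eventually_ge_atTop (B - A)]
    with L hL hBL
  rw [integral_mul_triWeight_sub_mul_triWeight_sub hAB hL hBL]
  rfl

/-- For the asymmetric triangular weight state, the shift of the average
position after translations by `A` and `B` differs from `(A+B)/2` by
`-3|A-B|/8` even in the broad-state limit `L → ∞`: the conditional work benefit
depends on the initial state of the weight. -/
theorem triangular_weight_average_position_limit (A B : ℝ) :
    Filter.Tendsto
      (fun L : ℝ =>
        (∫ x : ℝ, x * triWeight L (x - A) * triWeight L (x - B)) - (A + B) / 2)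
      Filter.atTop (nhds (-(3 * |A - B|) / 8)) := by
  rcases le_total A B with h | h
  · exact tendsto_integral_mul_triWeight_of_le h
  · rw [abs_sub_comm, add_comm A B]
    simp_rw [mul_right_comm _ (triWeight _ (_ - A))]
    exact tendsto_integral_mul_triWeight_of_le h
end
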